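/- Let n ≥ 1 and 0 < q₁ ≤ p₂ < min{p₁, q₂} with p₁ ≤ q₂ < ∞. Let v₁, v₂ be weights on ℝⁿ and w₁, w₂ weights on (0,∞) such that W_i(t) := ∫_t^∞ w_i(s)^{q_i} ds < ∞ for all t > 0, i = 1,2. Set V := v₁^{-p₁p₂/(p₁-p₂)} v₂^{p₁p₂/(p₁-p₂)} on ℝⁿ. Then there exists a constant C with ‖f‖_{LM_{p₂,q₂}(v₂,w₂)} ≤ C ‖f‖_{LM_{p₁,q₁}(v₁,w₁)} for all nonnegative measurable f on ℝⁿ if and only if I₁ := sup_{x>0} W₁(x)^{-1/q₁} · sup_{t>x} (∫_{B(x,t)} V)^{(p₁-p₂)/(p₁p₂)} · W₂(t)^{1/q₂} is finite; moreover the least such constant C is comparable to I₁. -/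

import Mathlib

open MeasureTheory Set ENNReal

noncomputable section

/-- The set `B(a,b) = {y ∈ ℝⁿ : a < |y| < b}`. -/
def annulus (n : ℕ) (a b : ℝ) : Set (EuclideanSpace ℝ (Fin n)) :=
  {y | a < ‖y‖ ∧ ‖y‖ < b}

/-- The weighted local Morrey-type functional `‖f‖_{LM_{p,q}(v,w)}`. -/
def LMnorm (n : ℕ) (p q : ℝ) (v : EuclideanSpace ℝ (Fin n) → ℝ≥0∞) (w : ℝ → ℝ≥0∞)
    (f : EuclideanSpace ℝ (Fin n) → ℝ≥0∞) : ℝ≥0∞ :=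
  (∫⁻ t in Ioi (0 : ℝ), (∫⁻ s in annulus n 0 t, f s ^ p * v s ^ p) ^ (q / p) * w t ^ q) ^ (1 / q)


theorem H_cofinal (S : Set ℝ) : ∃ D : Set ℝ, D.Countable ∧ D ⊆ S ∧ ∀ x ∈ S, ∃ d ∈ D, x ≤ d := by
  by_cases h : ∃ m ∈ S, ∀ x ∈ S, x ≤ m
  · obtain ⟨m, hm, h⟩ := h
    exact ⟨{m}, countable_singleton m, by simpa using hm, fun x hx => ⟨m, rfl, h x hx⟩⟩
  · push Not at h
    obtain ⟨D, hD, hd⟩ := TopologicalSpace.exists_countable_dense S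
    refine ⟨Subtype.val '' D, hD.image _, by rintro _ ⟨x, -, rfl⟩; exact x.2, fun x hx => ?_⟩
    obtain ⟨y, hy, hxy⟩ := h x hx
    obtain ⟨z, hz, hzD⟩ := hd.inter_open_nonempty {z : S | x < z.1}
      (isOpen_lt continuous_const continuous_subtype_val) ⟨⟨y, hy⟩, hxy⟩
    exact ⟨z, ⟨z, hzD, rfl⟩, le_of_lt hz⟩

theorem H_L0 {α : Type*} [MeasurableSpace α] (m : Measure α) (φ : α → ℝ) (J : Set α) (c : ℝ≥0∞)
    (h : ∀ x ∈ J, m (J ∩ {y | φ y ≤ φ x}) ≤ c) : m J ≤ c := by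
  obtain ⟨D, hD, hDS, hc⟩ := H_cofinal (φ '' J)
  have : J ⊆ ⋃ d ∈ D, J ∩ {y | φ y ≤ d} := by
    intro y hy
    obtain ⟨d, hd, hyd⟩ := hc (φ y) ⟨y, hy, rfl⟩
    simp only [mem_iUnion]
    exact ⟨d, hd, hy, hyd⟩
  refine (measure_mono this).trans ?_
  rw [measure_biUnion_eq_iSup hD]
  · refine iSup₂_le fun d hd => ?_
    obtain ⟨x, hx, rfl⟩ := hDS hd
    exact h x hx
  · intro a ha b hb
    rcases le_total a b with hab | hab
    · exact ⟨b, hb, fun y hy => ⟨hy.1, le_trans hy.2 hab⟩, fun y hy => hy⟩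
    · exact ⟨a, ha, fun y hy => hy, fun y hy => ⟨hy.1, le_trans hy.2 hab⟩⟩

theorem H_L {α : Type*} [MeasurableSpace α] (m : Measure α) (φ : α → ℝ)
    (h0 : ∀ s, m {y | φ y = s} = 0) (c : ℝ≥0∞) :
    m {y | m {z | φ z < φ y} ≤ c} ≤ c := by
  apply H_L0 m φ
  intro x hx
  calc _ ≤ m ({z | φ z < φ x} ∪ {z | φ z = φ x}) := by
        apply measure_mono
        rintro y ⟨-, hy⟩
        exact lt_or_eq_of_le (show φ y ≤ φ x from hy)
    _ ≤ m {z | φ z < φ x} + m {z | φ z = φ x} := measure_union_le _ _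
    _ ≤ c := by rw [h0, add_zero]; exact hx

theorem H_two (j : ℤ) : (2:ℝ≥0∞)^(j+1) = 2 ^ j + 2 ^ j := by
  rw [ENNReal.zpow_add (by simp) (by simp)]; simp [mul_two]

theorem H_disj (a b : ℤ) (x : ℝ≥0∞) (ha : x ∈ Ioc ((2:ℝ≥0∞)^a) (2^(a+1)))
    (hb : x ∈ Ioc ((2:ℝ≥0∞)^b) (2^(b+1))) : a = b := by
  by_contra hne
  rcases lt_or_gt_of_ne hne with h | h
  · have := ENNReal.zpow_le_of_le (x := 2) (by norm_num) (show a + 1 ≤ b by lia)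
    exact absurd (ha.2.trans this) (not_le.2 hb.1)
  · have := ENNReal.zpow_le_of_le (x := 2) (by norm_num) (show b + 1 ≤ a by lia)
    exact absurd (hb.2.trans this) (not_le.2 ha.1)

theorem H_overlap {α : Type*} [MeasurableSpace α] (γ : Measure α) (M : α → ℝ≥0∞)
    (hM : Measurable M) :
    ∑' j : ℤ, γ {y | M y ∈ Ioc ((2:ℝ≥0∞)^(j-1)) (2^(j+1))} ≤ 2 * γ univ := by
  have key : ∑' j : ℤ, γ {y | M y ∈ Ioc ((2:ℝ≥0∞)^j) (2^(j+1))} ≤ γ univ := by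
    rw [← measure_iUnion]
    · exact measure_mono (subset_univ _)
    · intro a b hab
      rw [Function.onFun, Set.disjoint_left]
      intro y ha hb
      exact hab (H_disj a b _ ha hb)
    · intro j
      exact hM measurableSet_Ioc
  calc _ ≤ ∑' j : ℤ, (γ {y | M y ∈ Ioc ((2:ℝ≥0∞)^(j-1)) (2^((j-1)+1))} +
          γ {y | M y ∈ Ioc ((2:ℝ≥0∞)^j) (2^(j+1))}) := by
        apply ENNReal.tsum_le_tsum
        intro j
        refine (measure_mono ?_).trans (measure_union_le _ _)
        rintro y ⟨h1, h2⟩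
        rcases le_or_gt (M y) (2^j) with h | h
        · left; exact ⟨h1, by simpa using h⟩
        · right; exact ⟨h, h2⟩
    _ = ∑' j : ℤ, γ {y | M y ∈ Ioc ((2:ℝ≥0∞)^(j-1)) (2^((j-1)+1))} +
          ∑' j : ℤ, γ {y | M y ∈ Ioc ((2:ℝ≥0∞)^j) (2^(j+1))} := ENNReal.tsum_add
    _ = ∑' j : ℤ, γ {y | M y ∈ Ioc ((2:ℝ≥0∞)^j) (2^(j+1))} +
          ∑' j : ℤ, γ {y | M y ∈ Ioc ((2:ℝ≥0∞)^j) (2^(j+1))} := by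
        congr 1
        exact (Equiv.subRight (1:ℤ)).tsum_eq
          (fun j => γ {y | M y ∈ Ioc ((2:ℝ≥0∞)^j) (2^(j+1))})
    _ ≤ _ := by rw [two_mul]; exact add_le_add key key

theorem H_tsum_rpow {ι : Type*} (x : ι → ℝ≥0∞) (s : ℝ) (hs : 1 ≤ s) :
    ∑' i, x i ^ s ≤ (∑' i, x i) ^ s := by
  have e : ∀ y : ℝ≥0∞, y ^ s = y * y ^ (s - 1) := by
    intro y
    have := ENNReal.rpow_add_of_nonneg (x := y) 1 (s-1) (by norm_num) (by linarith)
    rw [ENNReal.rpow_one] at this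
    rw [← this]; congr 1; ring
  calc ∑' i, x i ^ s = ∑' i, x i * x i ^ (s-1) := by simp_rw [← e]
    _ ≤ ∑' i, x i * (∑' i, x i) ^ (s-1) := by
      gcongr with i
      exact ENNReal.le_tsum i
    _ = (∑' i, x i) ^ s := by rw [ENNReal.tsum_mul_right, ← e]

theorem H_minkowski {α ι : Type*} [MeasurableSpace α] [Countable ι] (μ : Measure α)
    (U : ι → α → ℝ≥0∞) (hU : ∀ i, Measurable (U i)) (Q : ℝ) (hQ : 1 ≤ Q) :
    (∫⁻ t, (∑' i, U i t) ^ Q ∂μ) ^ (1/Q) ≤ ∑' i, (∫⁻ t, U i t ^ Q ∂μ) ^ (1/Q) := by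
  classical
  have hQ0 : 0 < Q := by linarith
  have fin : ∀ s : Finset ι, (∫⁻ t, (∑ i ∈ s, U i t) ^ Q ∂μ) ^ (1/Q) ≤
      ∑ i ∈ s, (∫⁻ t, U i t ^ Q ∂μ) ^ (1/Q) := by
    intro s
    induction s using Finset.induction_on with
    | empty => simp [hQ0]
    | insert a s ha ih =>
      simp only [Finset.sum_insert ha]
      refine le_trans ?_ (add_le_add le_rfl ih)
      exact ENNReal.lintegral_Lp_add_le (hU a).aemeasurable
        (Finset.measurable_fun_sum s fun i _ => hU i).aemeasurable hQ
  have e : ∀ t, (∑' i, U i t) ^ Q = ⨆ s : Finset ι, (∑ i ∈ s, U i t) ^ Q := by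
    intro t
    rw [ENNReal.tsum_eq_iSup_sum]
    exact (ENNReal.orderIsoRpow Q hQ0).map_iSup _
  simp_rw [e]
  rw [lintegral_iSup_directed]
  · have := (ENNReal.orderIsoRpow (1/Q) (by positivity)).map_iSup
      (fun s : Finset ι => ∫⁻ t, (∑ i ∈ s, U i t) ^ Q ∂μ)
    simp only [ENNReal.orderIsoRpow_apply] at this
    rw [this]
    exact iSup_le fun s => (fin s).trans (ENNReal.sum_le_tsum s)
  · intro s
    exact ((Finset.measurable_fun_sum s fun i _ => hU i).pow_const Q).aemeasurable
  · intro a b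
    refine ⟨a ∪ b, fun t => ?_, fun t => ?_⟩
    · exact ENNReal.rpow_le_rpow (Finset.sum_le_sum_of_subset Finset.subset_union_left) hQ0.le
    · exact ENNReal.rpow_le_rpow (Finset.sum_le_sum_of_subset Finset.subset_union_right) hQ0.le

theorem H_hardy {α : Type*} [MeasurableSpace α] (φ : α → ℝ) (hφ : Measurable φ)
    (ν γ V : Measure α) (μ : Measure ℝ) (a b Q : ℝ) (ha : 0 < a) (hb : 0 < b) (hQ : 0 < Q)
    (haQ : 1 ≤ a * Q)
    (hold : ∀ E, MeasurableSet E → ν E ≤ γ E ^ a * V E ^ b)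
    (hν0 : ∀ s, ν {y | φ y = s} = 0) (hμ0 : ∀ s, μ {s} = 0)
    (hμpos : ∀ t, μ (Ioi t) ≠ 0)
    (K : ℝ≥0∞) (hK0 : K ≠ 0) (hKt : K ≠ ⊤)
    (hK : ∀ t, V {y | φ y < t} ^ b * μ (Ioi t) ^ (1/Q) ≤ K) :
    ∫⁻ t, ν {y | φ y < t} ^ Q ∂μ ≤ (4 * K) ^ Q * (2 * γ univ) ^ (a * Q) := by
  by_cases hγ : γ univ = ⊤
  · rw [hγ, ENNReal.mul_top (by simp), ENNReal.top_rpow_of_pos (by positivity), ENNReal.mul_top]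
    · exact le_top
    · simp [hK0, hQ, hQ.le]
  have hm : ∀ t, MeasurableSet {y | φ y < t} := fun t => hφ measurableSet_Iio
  set U : ℝ → ℝ≥0∞ := fun t => ν {y | φ y < t} with hU
  have hUmono : Monotone U := fun s t hst => measure_mono fun y hy => lt_of_lt_of_le hy hst
  have hUm : Measurable U := hUmono.measurable
  have hUtop : ∀ t, U t ≠ ⊤ := by
    intro t ht
    have h1 := hold _ (hm t)
    have h2 : V {y | φ y < t} ^ b ≠ ⊤ := by
      intro h
      have := hK t
      rw [h, ENNReal.top_mul] at this
      · exact hKt (top_le_iff.1 this)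
      · simp [ENNReal.rpow_eq_zero_iff, hμpos, hQ, hQ.le]
    have h3 : γ {y | φ y < t} ^ a ≠ ⊤ :=
      ENNReal.rpow_ne_top_of_nonneg ha.le
        (ne_top_of_le_ne_top hγ (measure_mono (subset_univ _)))
    change ν {y | φ y < t} = ⊤ at ht
    rw [ht] at h1
    exact ENNReal.mul_ne_top h3 h2 (top_le_iff.1 h1)
  set T : ℤ → Set ℝ := fun j => {t | U t ∈ Ioc ((2:ℝ≥0∞)^j) (2^(j+1))} with hT
  have hTm : ∀ j, MeasurableSet (T j) := fun j => hUm measurableSet_Ioc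
  set E : ℤ → Set α := fun j => {y | U (φ y) ∈ Ioc ((2:ℝ≥0∞)^(j-1)) (2^(j+1))} with hE
  have step : ∀ j, ∫⁻ t in T j, U t ^ Q ∂μ ≤ (4 * K) ^ Q * γ (E j) ^ (a * Q) := by
    intro j
    calc ∫⁻ t in T j, U t ^ Q ∂μ ≤ ∫⁻ t in T j, ((2:ℝ≥0∞)^(j+1)) ^ Q ∂μ := by
          apply setLIntegral_mono' (hTm j)
          intro t ht
          exact ENNReal.rpow_le_rpow ht.2 hQ.le
      _ = ((((2:ℝ≥0∞)^(j+1)) ^ Q) • μ) (T j) := by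
          rw [setLIntegral_const, Measure.smul_apply, smul_eq_mul]
      _ ≤ _ := by
          apply H_L0 _ (fun t => -t)
          intro t ht
          rw [Measure.smul_apply, smul_eq_mul]
          have h1 : μ (T j ∩ {y | -y ≤ -t}) ≤ μ (Ioi t) := by
            calc _ ≤ μ (Ioi t ∪ {t}) := by
                  apply measure_mono
                  rintro y ⟨-, hy⟩
                  have hy : -y ≤ -t := hy
                  rcases eq_or_lt_of_le (neg_le_neg_iff.1 hy) with h | h
                  · right; exact h.symm
                  · left; exact h
              _ ≤ μ (Ioi t) + μ {t} := measure_union_le _ _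
              _ = _ := by rw [hμ0, add_zero]
          set F : Set α := {y | φ y < t ∧ (2:ℝ≥0∞)^(j-1) < U (φ y)} with hF
          have hFm : MeasurableSet F :=
            (hm t).inter ((hUm.comp hφ) measurableSet_Ioi)
          have h2 : (2:ℝ≥0∞)^(j-1) ≤ ν F := by
            have : U t ≤ 2^(j-1) + ν F := by
              calc U t ≤ ν ({y | ν {z | φ z < φ y} ≤ 2^(j-1)} ∪ F) := by
                    apply measure_mono
                    intro y hy
                    rcases le_or_gt (U (φ y)) (2^(j-1)) with h | h
                    · left; exact h
                    · right; exact ⟨hy, h⟩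
                _ ≤ _ := (measure_union_le _ _).trans
                    (add_le_add (H_L ν φ hν0 _) le_rfl)
            have h3 := ht.1.le.trans this
            have h4 := H_two (j-1)
            rw [sub_add_cancel] at h4
            rw [h4] at h3
            exact (ENNReal.add_le_add_iff_left (ENNReal.zpow_ne_top (by simp) (by simp) _)).1 h3
          have h3 : ν F ≤ γ (E j) ^ a * V {y | φ y < t} ^ b := by
            refine (hold F hFm).trans ?_
            gcongr
            · intro y hy
              exact ⟨hy.2, (hUmono hy.1.le).trans ht.2⟩
            · intro y hy
              exact hy.1
          have h4 : (2:ℝ≥0∞)^(j+1) = 4 * 2^(j-1) := by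
            have e1 := H_two j
            have e2 := H_two (j-1)
            rw [sub_add_cancel] at e2
            rw [e1, e2]; ring
          calc _ ≤ ((2:ℝ≥0∞)^(j+1)) ^ Q * μ (Ioi t) := by gcongr
            _ = ((2:ℝ≥0∞)^(j+1) * μ (Ioi t) ^ (1/Q)) ^ Q := by
                rw [ENNReal.mul_rpow_of_nonneg _ _ hQ.le, ← ENNReal.rpow_mul]
                rw [one_div_mul_cancel hQ.ne', ENNReal.rpow_one]
            _ ≤ ((4 * K) * γ (E j) ^ a) ^ Q := by
                apply ENNReal.rpow_le_rpow _ hQ.le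
                rw [h4]
                calc _ ≤ 4 * (γ (E j) ^ a * V {y | φ y < t} ^ b) * μ (Ioi t) ^ (1/Q) := by
                      gcongr; exact h2.trans h3
                  _ = 4 * (V {y | φ y < t} ^ b * μ (Ioi t) ^ (1/Q)) * γ (E j) ^ a := by ring
                  _ ≤ _ := by gcongr; exact hK t
            _ = _ := by rw [ENNReal.mul_rpow_of_nonneg _ _ hQ.le, ← ENNReal.rpow_mul]
  calc ∫⁻ t, U t ^ Q ∂μ ≤ ∫⁻ t, ∑' j, (T j).indicator (fun t => U t ^ Q) t ∂μ := by
        apply lintegral_mono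
        intro t
        by_cases h0 : U t = 0
        · simp [h0, hQ]
        · obtain ⟨j, hj⟩ := ENNReal.exists_mem_Ioc_zpow h0 (hUtop t) (y := 2)
            (by norm_num) (by simp)
          refine le_trans ?_ (ENNReal.le_tsum j)
          rw [indicator_of_mem (show t ∈ T j from hj)]
    _ = ∑' j, ∫⁻ t in T j, U t ^ Q ∂μ := by
        rw [lintegral_tsum fun j => ((hUm.pow_const Q).indicator (hTm j)).aemeasurable]
        simp_rw [lintegral_indicator (hTm _)]
    _ ≤ ∑' j, (4 * K) ^ Q * γ (E j) ^ (a * Q) := ENNReal.tsum_le_tsum step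
    _ ≤ (4 * K) ^ Q * (∑' j, γ (E j)) ^ (a * Q) := by
        rw [ENNReal.tsum_mul_left]; gcongr; exact H_tsum_rpow _ _ haQ
    _ ≤ _ := by
        gcongr
        exact H_overlap γ (fun y => U (φ y)) (hUm.comp hφ)

theorem H_blocks {α : Type*} [MeasurableSpace α] (φ : α → ℝ)
    (γ : Measure α) (μ : Measure ℝ) (s : ℝ) (hs : 0 < s) (hμ0 : ∀ s, μ {s} = 0) :
    ∑' k : ℤ, (2:ℝ≥0∞)^(k-1) * γ {y | 0 < φ y ∧ μ (Ioi (φ y)) ∈ Ioc ((2:ℝ≥0∞)^k) (2^(k+1))} ^ s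
      ≤ 2 * ∫⁻ t, γ {y | 0 < φ y ∧ φ y < t} ^ s ∂μ := by
  set W : ℝ → ℝ≥0∞ := fun t => μ (Ioi t) with hW
  have hWa : Antitone W := fun a b hab => measure_mono (Ioi_subset_Ioi hab)
  have hWm : Measurable W := hWa.measurable
  set G : ℝ → ℝ≥0∞ := fun t => γ {y | 0 < φ y ∧ φ y < t} ^ s with hG
  set T : ℤ → Set ℝ := fun k => {t | W t ∈ Ioc ((2:ℝ≥0∞)^(k-1)) (2^(k+1))} with hT
  have hTm : ∀ k, MeasurableSet (T k) := fun j => hWm measurableSet_Ioc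
  have hov := H_overlap (μ.withDensity G) W hWm
  rw [withDensity_apply _ MeasurableSet.univ, Measure.restrict_univ] at hov
  refine le_trans (ENNReal.tsum_le_tsum fun k => ?_) hov
  rw [withDensity_apply _ (hTm k)]
  set D := ∫⁻ t in T k, G t ∂μ with hD
  set B := {y | 0 < φ y ∧ μ (Ioi (φ y)) ∈ Ioc ((2:ℝ≥0∞)^k) (2^(k+1))} with hB
  have h20 : (2:ℝ≥0∞)^(k-1) ≠ 0 := (ENNReal.zpow_pos (by simp) (by simp) _).ne'
  have h2t : (2:ℝ≥0∞)^(k-1) ≠ ⊤ := ENNReal.zpow_ne_top (by simp) (by simp) _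
  have main : γ B ≤ (D / 2^(k-1)) ^ (1/s) := by
    apply H_L0 γ φ
    intro x hx
    rw [one_div, ENNReal.le_rpow_inv_iff hs, ENNReal.le_div_iff_mul_le (.inl h20) (.inl h2t)]
    set F : Set ℝ := {t | φ x < t ∧ (2:ℝ≥0∞)^(k-1) < W t} with hF
    have hFm : MeasurableSet F := measurableSet_Ioi.inter (hWm measurableSet_Ioi)
    have h2 : (2:ℝ≥0∞)^(k-1) ≤ μ F := by
      have : W (φ x) ≤ 2^(k-1) + μ F := by
        have hL := H_L μ (fun t => -t) (fun s => by
          have : {y : ℝ | -y = s} = {-s} := by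
            ext y; simp [neg_eq_iff_eq_neg]
          rw [this]; exact hμ0 _) (2^(k-1))
        simp only [neg_lt_neg_iff] at hL
        calc W (φ x) ≤ μ ({y | μ {z | y < z} ≤ 2^(k-1)} ∪ F) := by
              apply measure_mono
              intro y hy
              rcases le_or_gt (W y) (2^(k-1)) with h | h
              · left; exact h
              · right; exact ⟨hy, h⟩
          _ ≤ _ := (measure_union_le _ _).trans (add_le_add hL le_rfl)
      have h3 := hx.2.1.le.trans this
      have h4 := H_two (k-1)
      rw [sub_add_cancel] at h4
      rw [h4] at h3
      exact (ENNReal.add_le_add_iff_left h2t).1 h3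
    calc _ ≤ γ (B ∩ {y | φ y ≤ φ x}) ^ s * μ F := by gcongr
      _ = ∫⁻ t in F, γ (B ∩ {y | φ y ≤ φ x}) ^ s ∂μ := by rw [setLIntegral_const]
      _ ≤ ∫⁻ t in F, G t ∂μ := by
          apply setLIntegral_mono' hFm
          intro t ht
          apply ENNReal.rpow_le_rpow _ hs.le
          apply measure_mono
          rintro y ⟨hy1, hy2⟩
          exact ⟨hy1.1, lt_of_le_of_lt hy2 ht.1⟩
      _ ≤ D := by
          apply lintegral_mono_set
          intro t ht
          exact ⟨ht.2, (hWa ht.1.le).trans hx.2.2⟩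
  calc _ ≤ (2:ℝ≥0∞)^(k-1) * ((D / 2^(k-1)) ^ (1/s)) ^ s := by gcongr
    _ = D := by
      rw [← ENNReal.rpow_mul, one_div_mul_cancel hs.ne', ENNReal.rpow_one,
        ENNReal.mul_div_cancel h20 h2t]

theorem H_suff {α : Type*} [MeasurableSpace α] (φ : α → ℝ) (hφ : Measurable φ)
    (ν γ V : Measure α) (μ₁ μ₂ : Measure ℝ) (p₁ p₂ q₁ q₂ : ℝ)
    (hq₁ : 0 < q₁) (hq₁p₂ : q₁ ≤ p₂) (hp₂p₁ : p₂ < p₁) (hp₂q₂ : p₂ < q₂) (hp₁q₂ : p₁ ≤ q₂)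
    (hold : ∀ E, MeasurableSet E → ν E ≤ γ E ^ (p₂/p₁) * V E ^ ((p₁-p₂)/p₁))
    (hν0 : ∀ s, ν {y | φ y = s} = 0) (hV0 : ∀ s, V {y | φ y = s} = 0)
    (h10 : ∀ s, μ₁ {s} = 0) (h20 : ∀ s, μ₂ {s} = 0)
    (h1p : ∀ t, μ₁ (Ioi t) ≠ 0) (h2p : ∀ t, μ₂ (Ioi t) ≠ 0)
    (h1t : ∀ t, 0 < t → μ₁ (Ioi t) ≠ ⊤) (h2t : ∀ t, 0 < t → μ₂ (Ioi t) ≠ ⊤)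
    (I : ℝ≥0∞) (hI0 : I ≠ 0) (hIt : I ≠ ⊤)
    (hI : ∀ x t, 0 < x → x < t → V {y | x < φ y ∧ φ y < t} ^ ((p₁-p₂)/(p₁*p₂)) *
      μ₂ (Ioi t) ^ (1/q₂) ≤ I * μ₁ (Ioi x) ^ (1/q₁)) :
    (∫⁻ t, ν {y | 0 < φ y ∧ φ y < t} ^ (q₂/p₂) ∂μ₂) ^ (1/q₂) ≤
      (4 * 2 ^ (p₂/p₁) * 8 ^ (p₂/q₁)) ^ (1/p₂) * I *
        (∫⁻ t, γ {y | 0 < φ y ∧ φ y < t} ^ (q₁/p₁) ∂μ₁) ^ (1/q₁) := by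
  have hp₂ : 0 < p₂ := by linarith
  have hp₁ : 0 < p₁ := by linarith
  have hq₂ : 0 < q₂ := by linarith
  have hd : 0 < p₁ - p₂ := by linarith
  set B : ℤ → Set α := fun k =>
    {y | 0 < φ y ∧ μ₁ (Ioi (φ y)) ∈ Ioc ((2:ℝ≥0∞)^k) (2^(k+1))} with hB
  have hWa : Antitone (fun t => μ₁ (Ioi t)) := fun a b hab => measure_mono (Ioi_subset_Ioi hab)
  have hBm : ∀ k, MeasurableSet (B k) := fun k =>
    (hφ measurableSet_Ioi).inter ((hWa.measurable.comp hφ) measurableSet_Ioc)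
  have hm : ∀ t, MeasurableSet {y | φ y < t} := fun t => hφ measurableSet_Iio
  set K : ℤ → ℝ≥0∞ := fun k => (I * ((2:ℝ≥0∞)^(k+1)) ^ (1/q₁)) ^ p₂ with hK
  have z0 : ∀ k : ℤ, (2:ℝ≥0∞)^k ≠ 0 := fun k => (ENNReal.zpow_pos (by simp) (by simp) _).ne'
  have zt : ∀ k : ℤ, (2:ℝ≥0∞)^k ≠ ⊤ := fun k => ENNReal.zpow_ne_top (by simp) (by simp) _
  have x0 : ∀ k : ℤ, I * ((2:ℝ≥0∞)^(k+1)) ^ (1/q₁) ≠ 0 := fun k =>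
    mul_ne_zero hI0 (ENNReal.rpow_pos (pos_iff_ne_zero.2 (z0 _)) (zt _)).ne'
  have xt : ∀ k : ℤ, I * ((2:ℝ≥0∞)^(k+1)) ^ (1/q₁) ≠ ⊤ := fun k =>
    ENNReal.mul_ne_top hIt (ENNReal.rpow_ne_top_of_nonneg (by positivity) (zt _))
  have hKb : ∀ k t, (V.restrict (B k)) {y | φ y < t} ^ ((p₁-p₂)/p₁) *
      μ₂ (Ioi t) ^ (1/(q₂/p₂)) ≤ K k := by
    intro k t
    rw [Measure.restrict_apply (hm t)]
    rcases le_or_gt t 0 with ht | ht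
    · have : {y | φ y < t} ∩ B k = ∅ := by
        ext y
        simp only [mem_inter_iff, mem_ofPred_eq, mem_empty_iff_false, iff_false, not_and, hB]
        intro h1 h2
        linarith
      rw [this, measure_empty, ENNReal.zero_rpow_of_pos (by positivity), zero_mul]
      exact zero_le
    have e1 : (p₁-p₂)/p₁ = ((p₁-p₂)/(p₁*p₂)) * p₂ := by field_simp
    have e2 : 1/(q₂/p₂) = (1/q₂) * p₂ := by field_simp
    rw [e1, e2, ENNReal.rpow_mul, ENNReal.rpow_mul, ← ENNReal.mul_rpow_of_nonneg _ _ hp₂.le]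
    apply ENNReal.rpow_le_rpow _ hp₂.le
    set w := μ₂ (Ioi t) ^ (1/q₂) with hw
    have w0 : w ≠ 0 := (ENNReal.rpow_pos (pos_iff_ne_zero.2 (h2p t)) (h2t t ht)).ne'
    have wt : w ≠ ⊤ := ENNReal.rpow_ne_top_of_nonneg (by positivity) (h2t t ht)
    have hr : 0 < (p₁-p₂)/(p₁*p₂) := by positivity
    rw [← ENNReal.le_div_iff_mul_le (.inl w0) (.inl wt), ← ENNReal.le_rpow_inv_iff hr]
    apply H_L0 V (fun y => - φ y)
    intro x hx
    rw [ENNReal.le_rpow_inv_iff hr, ENNReal.le_div_iff_mul_le (.inl w0) (.inl wt)]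
    have h1 : V ({y | φ y < t} ∩ B k ∩ {y | -φ y ≤ -φ x}) ≤ V {y | φ x < φ y ∧ φ y < t} := by
      calc _ ≤ V ({y | φ x < φ y ∧ φ y < t} ∪ {y | φ y = φ x}) := by
            apply measure_mono
            rintro y ⟨⟨hy, -⟩, hy2⟩
            have hy2 : -φ y ≤ -φ x := hy2
            rcases eq_or_lt_of_le (neg_le_neg_iff.1 hy2) with h | h
            · right; exact h.symm
            · left; exact ⟨h, hy⟩
        _ ≤ _ := measure_union_le _ _
        _ = _ := by rw [hV0, add_zero]
    calc _ ≤ V {y | φ x < φ y ∧ φ y < t} ^ ((p₁-p₂)/(p₁*p₂)) * w := by gcongr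
      _ ≤ I * μ₁ (Ioi (φ x)) ^ (1/q₁) := hI _ _ hx.2.1 hx.1
      _ ≤ _ := by gcongr; exact hx.2.2.2
  have hardy : ∀ k, (∫⁻ t, (ν.restrict (B k)) {y | φ y < t} ^ (q₂/p₂) ∂μ₂) ^ (1/(q₂/p₂)) ≤
      (4 * K k) * (2 * γ (B k)) ^ (p₂/p₁) := by
    intro k
    have hQ : 0 < q₂/p₂ := by positivity
    have := H_hardy φ hφ (ν.restrict (B k)) (γ.restrict (B k)) (V.restrict (B k)) μ₂
      (p₂/p₁) ((p₁-p₂)/p₁) (q₂/p₂) (by positivity) (by positivity) hQ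
      (by rw [show p₂/p₁ * (q₂/p₂) = q₂/p₁ by field_simp, le_div_iff₀ hp₁]; linarith)
      (fun E hE => by
        rw [Measure.restrict_apply hE, Measure.restrict_apply hE, Measure.restrict_apply hE]
        exact hold _ (hE.inter (hBm k)))
      (fun s => le_antisymm ((Measure.restrict_apply_le _ _).trans (hν0 s).le) zero_le)
      h20 h2p (K k)
      (ENNReal.rpow_pos (pos_iff_ne_zero.2 (x0 k)) (xt k)).ne'
      (ENNReal.rpow_ne_top_of_nonneg hp₂.le (xt k)) (hKb k)
    rw [Measure.restrict_apply_univ] at this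
    rw [one_div, ENNReal.rpow_inv_le_iff hQ, ENNReal.mul_rpow_of_nonneg _ _ hQ.le,
      ← ENNReal.rpow_mul]
    exact this
  have split : ∀ t, ν {y | 0 < φ y ∧ φ y < t} ≤ ∑' k, (ν.restrict (B k)) {y | φ y < t} := by
    intro t
    calc _ ≤ ν (⋃ k, {y | φ y < t} ∩ B k) := by
          apply measure_mono
          rintro y ⟨h1, h2⟩
          obtain ⟨k, hk⟩ := ENNReal.exists_mem_Ioc_zpow (h1p (φ y)) (h1t _ h1) (y := 2)
            (by norm_num) (by simp)
          exact mem_iUnion.2 ⟨k, h2, h1, hk⟩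
      _ ≤ ∑' k, ν ({y | φ y < t} ∩ B k) := measure_iUnion_le _
      _ = _ := by simp_rw [Measure.restrict_apply (hm t)]
  have bl := H_blocks φ γ μ₁ (q₁/p₁) (by positivity) h10
  change ∑' k : ℤ, (2:ℝ≥0∞)^(k-1) * γ (B k) ^ (q₁/p₁) ≤ _ at bl
  set R := ∫⁻ t, γ {y | 0 < φ y ∧ φ y < t} ^ (q₁/p₁) ∂μ₁ with hR
  have e8 : 8 * R = 4 * (2 * R) := by rw [← mul_assoc]; norm_num
  have main : (∫⁻ t, ν {y | 0 < φ y ∧ φ y < t} ^ (q₂/p₂) ∂μ₂) ^ (1/(q₂/p₂)) ≤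
      4 * 2 ^ (p₂/p₁) * I ^ p₂ * (8 * R) ^ (p₂/q₁) := by
    calc _ ≤ (∫⁻ t, (∑' k, (ν.restrict (B k)) {y | φ y < t}) ^ (q₂/p₂) ∂μ₂) ^ (1/(q₂/p₂)) := by
          gcongr with t
          exact split t
      _ ≤ ∑' k, (∫⁻ t, (ν.restrict (B k)) {y | φ y < t} ^ (q₂/p₂) ∂μ₂) ^ (1/(q₂/p₂)) := by
          apply H_minkowski
          · intro k
            have : Monotone fun t => (ν.restrict (B k)) {y | φ y < t} :=
              fun s t hst => measure_mono fun y hy => lt_of_lt_of_le hy hst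
            exact this.measurable
          · rw [le_div_iff₀ hp₂]; linarith
      _ ≤ ∑' k, (4 * K k) * (2 * γ (B k)) ^ (p₂/p₁) := ENNReal.tsum_le_tsum hardy
      _ = ∑' k, (4 * 2 ^ (p₂/p₁) * I ^ p₂) *
            ((2:ℝ≥0∞)^(k+1) * γ (B k) ^ (q₁/p₁)) ^ (p₂/q₁) := by
          congr 1; ext k
          simp only [hK]
          rw [ENNReal.mul_rpow_of_nonneg _ _ hp₂.le, ENNReal.mul_rpow_of_nonneg _ _ (by positivity),
            ENNReal.mul_rpow_of_nonneg _ _ (by positivity), ← ENNReal.rpow_mul, ← ENNReal.rpow_mul,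
            show 1/q₁*p₂ = p₂/q₁ by field_simp, show q₁/p₁*(p₂/q₁) = p₂/p₁ by field_simp]
          ring
      _ ≤ (4 * 2 ^ (p₂/p₁) * I ^ p₂) *
            (∑' k, (2:ℝ≥0∞)^(k+1) * γ (B k) ^ (q₁/p₁)) ^ (p₂/q₁) := by
          rw [ENNReal.tsum_mul_left]
          gcongr
          apply H_tsum_rpow
          rw [le_div_iff₀ hq₁]; linarith
      _ ≤ _ := by
          gcongr
          rw [e8]
          refine le_trans (le_of_eq ?_) (mul_le_mul_right bl 4)
          rw [← ENNReal.tsum_mul_left]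
          congr 1; ext k
          have e1 := H_two k
          have e2 := H_two (k-1)
          rw [sub_add_cancel] at e2
          rw [e1, e2]; ring
  have e3 : (1/q₂ : ℝ) = (1/(q₂/p₂)) * (1/p₂) := by field_simp
  rw [e3, ENNReal.rpow_mul]
  refine (ENNReal.rpow_le_rpow main (by positivity)).trans (le_of_eq ?_)
  have hp : 0 ≤ 1/p₂ := by positivity
  rw [ENNReal.mul_rpow_of_nonneg _ R (by positivity)]
  rw [show (4 * 2 ^ (p₂/p₁) * I ^ p₂ * (8 ^ (p₂/q₁) * R ^ (p₂/q₁)) : ℝ≥0∞) =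
    (4 * 2 ^ (p₂/p₁) * 8 ^ (p₂/q₁)) * I ^ p₂ * R ^ (p₂/q₁) by ring]
  rw [ENNReal.mul_rpow_of_nonneg _ _ hp, ENNReal.mul_rpow_of_nonneg _ (I ^ p₂) hp,
    ← ENNReal.rpow_mul, ← ENNReal.rpow_mul, mul_one_div_cancel hp₂.ne', ENNReal.rpow_one,
    show p₂/q₁*(1/p₂) = 1/q₁ by field_simp]

theorem H_holder {α : Type*} [MeasurableSpace α] (m : Measure α) (p₁ p₂ : ℝ)
    (hp₂ : 0 < p₂) (h : p₂ < p₁) (f v₁ v₂ : α → ℝ≥0∞) (hf : Measurable f) (hv₁m : Measurable v₁)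
    (hv₂m : Measurable v₂) (hv₁ : ∀ᵐ x ∂m, 0 < v₁ x ∧ v₁ x < ⊤) :
    ∫⁻ s, f s ^ p₂ * v₂ s ^ p₂ ∂m ≤ (∫⁻ s, f s ^ p₁ * v₁ s ^ p₁ ∂m) ^ (p₂/p₁) *
      (∫⁻ s, v₁ s ^ (-(p₁ * p₂ / (p₁ - p₂))) * v₂ s ^ (p₁ * p₂ / (p₁ - p₂)) ∂m) ^ ((p₁-p₂)/p₁) := by
  have hp₁ : 0 < p₁ := by linarith
  have hd : 0 < p₁ - p₂ := by linarith
  have hc : (p₁/p₂).HolderConjugate (p₁/(p₁-p₂)) := by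
    rw [Real.holderConjugate_iff]
    refine ⟨by rw [lt_div_iff₀ hp₂]; linarith, by field_simp; ring⟩
  have := ENNReal.lintegral_mul_le_Lp_mul_Lq m hc
    (f := fun s => f s ^ p₂ * v₁ s ^ p₂) (g := fun s => v₁ s ^ (-p₂) * v₂ s ^ p₂)
    (by fun_prop) (by fun_prop)
  calc _ = ∫⁻ s, ((fun s => f s ^ p₂ * v₁ s ^ p₂) * fun s => v₁ s ^ (-p₂) * v₂ s ^ p₂) s ∂m := by
        apply lintegral_congr_ae
        filter_upwards [hv₁] with s hs
        have : v₁ s ^ p₂ * v₁ s ^ (-p₂) = 1 := by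
          rw [← ENNReal.rpow_add _ _ hs.1.ne' hs.2.ne]; simp
        simp only [Pi.mul_apply]
        calc _ = f s ^ p₂ * (v₁ s ^ p₂ * v₁ s ^ (-p₂)) * v₂ s ^ p₂ := by rw [this, mul_one]
          _ = _ := by ring
    _ ≤ _ := this
    _ = _ := by
        have a1 : 0 ≤ p₁/p₂ := by positivity
        have a2 : 0 ≤ p₁/(p₁-p₂) := by positivity
        simp_rw [ENNReal.mul_rpow_of_nonneg _ _ a1, ENNReal.mul_rpow_of_nonneg _ _ a2,
          ← ENNReal.rpow_mul]
        rw [show p₂ * (p₁/p₂) = p₁ by field_simp,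
          show -p₂ * (p₁/(p₁-p₂)) = -(p₁ * p₂ / (p₁ - p₂)) by field_simp,
          show p₂ * (p₁/(p₁-p₂)) = p₁ * p₂ / (p₁ - p₂) by field_simp, one_div_div, one_div_div]

theorem H_test (V v₁ v₂ : ℝ≥0∞) (p₁ p₂ : ℝ) (hp₂ : 0 < p₂) (h : p₂ < p₁)
    (hv : 0 < v₁ ∧ v₁ < ⊤)
    (hV : V = v₁ ^ (-(p₁ * p₂ / (p₁ - p₂))) * v₂ ^ (p₁ * p₂ / (p₁ - p₂))) :
    (V ^ (1/p₁) * v₁⁻¹) ^ p₁ * v₁ ^ p₁ = V ∧ (V ^ (1/p₁) * v₁⁻¹) ^ p₂ * v₂ ^ p₂ = V := by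
  have hp₁ : 0 < p₁ := by linarith
  have hd : 0 < p₁ - p₂ := by linarith
  constructor
  · rw [← ENNReal.mul_rpow_of_nonneg _ _ hp₁.le, mul_assoc,
      ENNReal.inv_mul_cancel hv.1.ne' hv.2.ne, mul_one, ← ENNReal.rpow_mul,
      one_div_mul_cancel hp₁.ne', ENNReal.rpow_one]
  · have e : v₁ ^ (-p₂) * v₂ ^ p₂ = V ^ ((p₁-p₂)/p₁) := by
      rw [hV, ENNReal.mul_rpow_of_nonneg _ _ (by positivity), ← ENNReal.rpow_mul,
        ← ENNReal.rpow_mul]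
      congr 2 <;> field_simp
    rw [ENNReal.mul_rpow_of_nonneg _ _ hp₂.le, ENNReal.inv_rpow, ← ENNReal.rpow_neg, mul_assoc, e,
      ← ENNReal.rpow_mul, ← ENNReal.rpow_add_of_nonneg _ _ (by positivity) (by positivity)]
    rw [show 1/p₁*p₂ + (p₁-p₂)/p₁ = 1 by field_simp; ring, ENNReal.rpow_one]

theorem H_ann_meas (n : ℕ) (a b : ℝ) : MeasurableSet (annulus n a b) :=
  (measurable_norm measurableSet_Ioi).inter (measurable_norm measurableSet_Iio)

theorem H_nec (n : ℕ) (p₁ p₂ q₁ q₂ : ℝ)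
    (hq₁ : 0 < q₁) (hp₂ : 0 < p₂) (hp₂p₁ : p₂ < p₁) (hq₂ : 0 < q₂)
    (v₁ v₂ V : EuclideanSpace ℝ (Fin n) → ℝ≥0∞) (w₁ w₂ : ℝ → ℝ≥0∞)
    (hv₁m : Measurable v₁)
    (hv₁ : ∀ᵐ x ∂(volume : Measure (EuclideanSpace ℝ (Fin n))), 0 < v₁ x ∧ v₁ x < ⊤)
    (hVm : Measurable V)
    (hV : ∀ x, V x = v₁ x ^ (-(p₁ * p₂ / (p₁ - p₂))) * v₂ x ^ (p₁ * p₂ / (p₁ - p₂)))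
    (C : ℝ≥0∞)
    (hC : ∀ f : EuclideanSpace ℝ (Fin n) → ℝ≥0∞, Measurable f →
        LMnorm n p₂ q₂ v₂ w₂ f ≤ C * LMnorm n p₁ q₁ v₁ w₁ f)
    (x t : ℝ) (hx : 0 < x) (hxt : x < t) (E : Set (EuclideanSpace ℝ (Fin n)))
    (hE : MeasurableSet E) (hEs : E ⊆ annulus n x t) (hEt : ∫⁻ y in E, V y ≠ ⊤) :
    (∫⁻ y in E, V y) ^ ((p₁ - p₂) / (p₁ * p₂)) * (∫⁻ s in Ioi t, w₂ s ^ q₂) ^ (1/q₂) ≤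
      C * (∫⁻ s in Ioi x, w₁ s ^ q₁) ^ (1/q₁) := by
  have hp₁ : 0 < p₁ := by linarith
  have hd : 0 < p₁ - p₂ := by linarith
  set f : EuclideanSpace ℝ (Fin n) → ℝ≥0∞ := E.indicator fun y => V y ^ (1/p₁) * (v₁ y)⁻¹ with hf
  have hfm : Measurable f := Measurable.indicator (by fun_prop) hE
  have key := hC f hfm
  set A := ∫⁻ y in E, V y with hA
  have f1 : (fun s => f s ^ p₁ * v₁ s ^ p₁) =ᵐ[volume] E.indicator V := by
    filter_upwards [hv₁] with y hy
    by_cases hyE : y ∈ E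
    · simp only [hf, indicator_of_mem hyE]
      exact (H_test _ _ _ p₁ p₂ hp₂ hp₂p₁ hy (hV y)).1
    · simp [hf, indicator_of_notMem hyE, hp₁]
  have f2 : (fun s => f s ^ p₂ * v₂ s ^ p₂) =ᵐ[volume] E.indicator V := by
    filter_upwards [hv₁] with y hy
    by_cases hyE : y ∈ E
    · simp only [hf, indicator_of_mem hyE]
      exact (H_test _ _ _ p₁ p₂ hp₂ hp₂p₁ hy (hV y)).2
    · simp [hf, indicator_of_notMem hyE, hp₂]
  have g1 : ∀ s, ∫⁻ y in annulus n 0 s, f y ^ p₁ * v₁ y ^ p₁ = ∫⁻ y in E ∩ annulus n 0 s, V y := by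
    intro s
    rw [lintegral_congr_ae (ae_restrict_of_ae f1), lintegral_indicator hE,
      Measure.restrict_restrict hE]
  have g2 : ∀ s, ∫⁻ y in annulus n 0 s, f y ^ p₂ * v₂ y ^ p₂ = ∫⁻ y in E ∩ annulus n 0 s, V y := by
    intro s
    rw [lintegral_congr_ae (ae_restrict_of_ae f2), lintegral_indicator hE,
      Measure.restrict_restrict hE]
  have low : A ^ (1/p₂) * (∫⁻ s in Ioi t, w₂ s ^ q₂) ^ (1/q₂) ≤ LMnorm n p₂ q₂ v₂ w₂ f := by
    unfold LMnorm
    simp_rw [g2]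
    have e : A ^ (1/p₂) = (A ^ (q₂/p₂)) ^ (1/q₂) := by
      rw [← ENNReal.rpow_mul]; congr 1; field_simp
    rw [e, ← ENNReal.mul_rpow_of_nonneg _ _ (by positivity)]
    apply ENNReal.rpow_le_rpow _ (by positivity)
    by_cases hA0 : A = 0
    · rw [hA0, ENNReal.zero_rpow_of_pos (by positivity), zero_mul]; exact zero_le
    rw [← lintegral_const_mul' _ _ (ENNReal.rpow_ne_top_of_nonneg (by positivity) hEt)]
    calc _ ≤ ∫⁻ s in Ioi t, (∫⁻ y in E ∩ annulus n 0 s, V y) ^ (q₂/p₂) * w₂ s ^ q₂ := by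
          apply setLIntegral_mono' measurableSet_Ioi
          intro s hs
          have : E ∩ annulus n 0 s = E := by
            apply inter_eq_left.2
            intro y hy
            have h := hEs hy
            exact ⟨hx.trans h.1, h.2.trans hs⟩
          rw [this]
      _ ≤ _ := lintegral_mono_set (Ioi_subset_Ioi (by linarith))
  have up : LMnorm n p₁ q₁ v₁ w₁ f ≤ A ^ (1/p₁) * (∫⁻ s in Ioi x, w₁ s ^ q₁) ^ (1/q₁) := by
    unfold LMnorm
    simp_rw [g1]
    have e : A ^ (1/p₁) = (A ^ (q₁/p₁)) ^ (1/q₁) := by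
      rw [← ENNReal.rpow_mul]; congr 1; field_simp
    rw [e, ← ENNReal.mul_rpow_of_nonneg _ _ (by positivity)]
    apply ENNReal.rpow_le_rpow _ (by positivity)
    rw [← lintegral_const_mul' _ _ (ENNReal.rpow_ne_top_of_nonneg (by positivity) hEt),
      ← lintegral_indicator measurableSet_Ioi, ← lintegral_indicator measurableSet_Ioi]
    apply lintegral_mono
    intro s
    by_cases hs : x < s
    · have hs0 : 0 < s := hx.trans hs
      simp only [indicator_of_mem (show s ∈ Ioi (0:ℝ) from hs0),
        indicator_of_mem (show s ∈ Ioi x from hs)]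
      gcongr
      exact lintegral_mono_set inter_subset_left
    · have : E ∩ annulus n 0 s = ∅ := by
        ext y
        simp only [mem_inter_iff, mem_empty_iff_false, iff_false, not_and]
        intro hy hy2
        have h1 := (hEs hy).1
        have h2 := hy2.2
        linarith
      have e0 : (0:ℝ≥0∞) ^ (q₁/p₁) = 0 := ENNReal.zero_rpow_of_pos (by positivity)
      by_cases hs0 : s ∈ Ioi (0:ℝ)
      · simp [indicator_of_mem hs0, this, e0]
      · simp [indicator_of_notMem hs0]
  have h := low.trans (key.trans (mul_le_mul_right up C))
  by_cases hA0 : A = 0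
  · rw [hA0, ENNReal.zero_rpow_of_pos (by positivity), zero_mul]; exact zero_le
  have z0 : A ^ (1/p₁) ≠ 0 := (ENNReal.rpow_pos (pos_iff_ne_zero.2 hA0) hEt).ne'
  have zt : A ^ (1/p₁) ≠ ⊤ := ENNReal.rpow_ne_top_of_nonneg (by positivity) hEt
  rw [show 1/p₂ = 1/p₁ + (p₁ - p₂) / (p₁ * p₂) by field_simp; ring,
    ENNReal.rpow_add _ _ hA0 hEt, mul_assoc, mul_left_comm C] at h
  exact (ENNReal.mul_le_mul_iff_right z0 zt).1 h

theorem H_mu (w : ℝ → ℝ≥0∞) (q : ℝ) (hq : 0 < q) (hwm : Measurable w)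
    (hw : ∀ᵐ t ∂(volume.restrict (Ioi (0 : ℝ))), 0 < w t ∧ w t < ⊤) (μ : Measure ℝ)
    (hμ : μ = (volume.restrict (Ioi (0 : ℝ))).withDensity (fun t => w t ^ q)) :
    (∀ t, 0 < t → μ (Ioi t) = ∫⁻ s in Ioi t, w s ^ q) ∧ (∀ s, μ {s} = 0) ∧
      (∀ t, μ (Ioi t) ≠ 0) ∧ ∀ g : ℝ → ℝ≥0∞, Measurable g →
        ∫⁻ t, g t ∂μ = ∫⁻ t in Ioi 0, g t * w t ^ q := by
  have hm : Measurable fun t => w t ^ q := hwm.pow_const q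
  refine ⟨?_, ?_, ?_, ?_⟩
  · intro t ht
    rw [hμ, withDensity_apply _ measurableSet_Ioi, Measure.restrict_restrict measurableSet_Ioi,
      inter_eq_left.2 (Ioi_subset_Ioi ht.le)]
  · intro s
    rw [hμ]
    apply withDensity_absolutelyContinuous
    exact measure_singleton s
  · intro t h
    rw [hμ, withDensity_apply _ measurableSet_Ioi, Measure.restrict_restrict measurableSet_Ioi,
      lintegral_eq_zero_iff hm] at h
    have h1 : ∀ᵐ s ∂(volume.restrict (Ioi t ∩ Ioi (0:ℝ))), 0 < w s ∧ w s < ⊤ :=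
      ae_mono (Measure.restrict_mono inter_subset_right le_rfl) hw
    have h2 : ∀ᵐ s ∂(volume.restrict (Ioi t ∩ Ioi (0:ℝ))), False := by
      filter_upwards [h, h1] with s hs hs1
      exact (ENNReal.rpow_pos hs1.1 hs1.2.ne).ne' hs
    rw [ae_iff] at h2
    simp only [not_false_eq_true, ofPred_true, Measure.restrict_apply_univ, Ioi_inter_Ioi,
      Real.volume_Ioi, ENNReal.top_ne_zero] at h2
  · intro g hg
    rw [hμ, lintegral_withDensity_eq_lintegral_mul _ hm hg]
    simp only [Pi.mul_apply, mul_comm]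

theorem H_ann_pos (n : ℕ) (hn : 1 ≤ n) : volume (annulus n 1 2) ≠ 0 := by
  haveI : Nonempty (Fin n) := ⟨⟨0, hn⟩⟩
  have ho : IsOpen (annulus n 1 2) :=
    (isOpen_lt continuous_const continuous_norm).inter (isOpen_lt continuous_norm continuous_const)
  obtain ⟨y, hy⟩ := exists_norm_eq (EuclideanSpace ℝ (Fin n))
    (show (0:ℝ) ≤ 3/2 by norm_num)
  exact (ho.measure_pos volume ⟨y, by rw [annulus]; constructor <;> rw [hy] <;> norm_num⟩).ne'

theorem H_sphere (n : ℕ) (hn : 1 ≤ n) (s : ℝ) :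
    volume {y : EuclideanSpace ℝ (Fin n) | ‖y‖ = s} = 0 := by
  haveI : Nonempty (Fin n) := ⟨⟨0, hn⟩⟩
  have := Measure.addHaar_sphere (volume : Measure (EuclideanSpace ℝ (Fin n))) 0 s
  convert this using 2
  ext y; simp

theorem statement5 (n : ℕ) (hn : 1 ≤ n) (p₁ p₂ q₁ q₂ : ℝ)
    (hq₁ : 0 < q₁) (hq₁p₂ : q₁ ≤ p₂) (hp₂p₁ : p₂ < p₁) (hp₂q₂ : p₂ < q₂) (hp₁q₂ : p₁ ≤ q₂)
    (v₁ v₂ : EuclideanSpace ℝ (Fin n) → ℝ≥0∞) (w₁ w₂ : ℝ → ℝ≥0∞)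
    (hv₁m : Measurable v₁)
    (hv₁ : ∀ᵐ x ∂(volume : Measure (EuclideanSpace ℝ (Fin n))), 0 < v₁ x ∧ v₁ x < ⊤)
    (hv₂m : Measurable v₂)
    (hv₂ : ∀ᵐ x ∂(volume : Measure (EuclideanSpace ℝ (Fin n))), 0 < v₂ x ∧ v₂ x < ⊤)
    (hw₁m : Measurable w₁)
    (hw₁ : ∀ᵐ t ∂(volume.restrict (Ioi (0 : ℝ))), 0 < w₁ t ∧ w₁ t < ⊤)
    (hw₂m : Measurable w₂)
    (hw₂ : ∀ᵐ t ∂(volume.restrict (Ioi (0 : ℝ))), 0 < w₂ t ∧ w₂ t < ⊤)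
    (hW₁ : ∀ t : ℝ, 0 < t → (∫⁻ s in Ioi t, w₁ s ^ q₁) < ⊤)
    (hW₂ : ∀ t : ℝ, 0 < t → (∫⁻ s in Ioi t, w₂ s ^ q₂) < ⊤) :
    let W₁ : ℝ → ℝ≥0∞ := fun t => ∫⁻ s in Ioi t, w₁ s ^ q₁
    let W₂ : ℝ → ℝ≥0∞ := fun t => ∫⁻ s in Ioi t, w₂ s ^ q₂
    let V : EuclideanSpace ℝ (Fin n) → ℝ≥0∞ := fun x =>
      v₁ x ^ (-(p₁ * p₂ / (p₁ - p₂))) * v₂ x ^ (p₁ * p₂ / (p₁ - p₂))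
    let I₁ : ℝ≥0∞ := ⨆ x ∈ Ioi (0 : ℝ), W₁ x ^ (-(1 / q₁)) *
      ⨆ t ∈ Ioi x, (∫⁻ y in annulus n x t, V y) ^ ((p₁ - p₂) / (p₁ * p₂)) * W₂ t ^ (1 / q₂)
    ((∃ C : ℝ≥0∞, C ≠ ⊤ ∧ ∀ f : EuclideanSpace ℝ (Fin n) → ℝ≥0∞, Measurable f →
        LMnorm n p₂ q₂ v₂ w₂ f ≤ C * LMnorm n p₁ q₁ v₁ w₁ f) ↔ I₁ < ⊤) ∧
    ∃ c₁ c₂ : ℝ≥0∞, 0 < c₁ ∧ c₂ ≠ ⊤ ∧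
      c₁ * I₁ ≤ sInf {C : ℝ≥0∞ | ∀ f : EuclideanSpace ℝ (Fin n) → ℝ≥0∞, Measurable f →
        LMnorm n p₂ q₂ v₂ w₂ f ≤ C * LMnorm n p₁ q₁ v₁ w₁ f} ∧
      sInf {C : ℝ≥0∞ | ∀ f : EuclideanSpace ℝ (Fin n) → ℝ≥0∞, Measurable f →
        LMnorm n p₂ q₂ v₂ w₂ f ≤ C * LMnorm n p₁ q₁ v₁ w₁ f} ≤ c₂ * I₁ := by
  intro W₁ W₂ V I₁
  have hp₂ : 0 < p₂ := by linarith
  have hp₁ : 0 < p₁ := by linarith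
  have hq₂ : 0 < q₂ := by linarith
  have hd : 0 < p₁ - p₂ := by linarith
  have hr : 0 < (p₁ - p₂) / (p₁ * p₂) := by positivity
  have hVm : Measurable V := (hv₁m.pow_const _).mul (hv₂m.pow_const _)
  have hVp : ∀ᵐ x, 0 < V x ∧ V x < ⊤ := by
    filter_upwards [hv₁, hv₂] with x h1 h2
    refine ⟨ENNReal.mul_pos (ENNReal.rpow_pos h1.1 h1.2.ne).ne'
      (ENNReal.rpow_pos h2.1 h2.2.ne).ne', ENNReal.mul_lt_top ?_ ?_⟩
    · exact (ENNReal.rpow_ne_top_of_ne_zero h1.1.ne' h1.2.ne).lt_top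
    · exact (ENNReal.rpow_ne_top_of_ne_zero h2.1.ne' h2.2.ne).lt_top
  obtain ⟨μ₁, hμ₁⟩ : ∃ μ, μ = (volume.restrict (Ioi (0 : ℝ))).withDensity (fun t => w₁ t ^ q₁) :=
    ⟨_, rfl⟩
  obtain ⟨μ₂, hμ₂⟩ : ∃ μ, μ = (volume.restrict (Ioi (0 : ℝ))).withDensity (fun t => w₂ t ^ q₂) :=
    ⟨_, rfl⟩
  obtain ⟨a1, a2, a3, a4⟩ := H_mu w₁ q₁ hq₁ hw₁m hw₁ μ₁ hμ₁
  obtain ⟨b1, b2, b3, b4⟩ := H_mu w₂ q₂ hq₂ hw₂m hw₂ μ₂ hμ₂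
  have W10 : ∀ t, 0 < t → W₁ t ≠ 0 := fun t ht => by
    have := a3 t; rwa [a1 t ht] at this
  have W20 : ∀ t, 0 < t → W₂ t ≠ 0 := fun t ht => by
    have := b3 t; rwa [b1 t ht] at this
  have W1t : ∀ t, 0 < t → W₁ t ≠ ⊤ := fun t ht => (hW₁ t ht).ne
  have W2t : ∀ t, 0 < t → W₂ t ≠ ⊤ := fun t ht => (hW₂ t ht).ne
  have r10 : ∀ t, 0 < t → W₁ t ^ (1/q₁) ≠ 0 := fun t ht =>
    (ENNReal.rpow_pos (pos_iff_ne_zero.2 (W10 t ht)) (W1t t ht)).ne'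
  have r1t : ∀ t, 0 < t → W₁ t ^ (1/q₁) ≠ ⊤ := fun t ht =>
    ENNReal.rpow_ne_top_of_nonneg (by positivity) (W1t t ht)
  have r20 : ∀ t, 0 < t → W₂ t ^ (1/q₂) ≠ 0 := fun t ht =>
    (ENNReal.rpow_pos (pos_iff_ne_zero.2 (W20 t ht)) (W2t t ht)).ne'
  have r2t : ∀ t, 0 < t → W₂ t ^ (1/q₂) ≠ ⊤ := fun t ht =>
    ENNReal.rpow_ne_top_of_nonneg (by positivity) (W2t t ht)
  have hI : ∀ x t, 0 < x → x < t → (∫⁻ y in annulus n x t, V y) ^ ((p₁ - p₂) / (p₁ * p₂)) *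
      W₂ t ^ (1 / q₂) ≤ I₁ * W₁ x ^ (1/q₁) := by
    intro x t hx hxt
    have h1 : W₁ x ^ (-(1 / q₁)) * ((∫⁻ y in annulus n x t, V y) ^ ((p₁ - p₂) / (p₁ * p₂)) *
        W₂ t ^ (1 / q₂)) ≤ I₁ := by
      refine le_trans ?_ (le_iSup₂ (f := fun x (_ : x ∈ Ioi (0:ℝ)) => W₁ x ^ (-(1 / q₁)) *
        ⨆ t ∈ Ioi x, (∫⁻ y in annulus n x t, V y) ^ ((p₁ - p₂) / (p₁ * p₂)) * W₂ t ^ (1 / q₂))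
        x hx)
      gcongr
      exact le_iSup₂ (f := fun t (_ : t ∈ Ioi x) =>
        (∫⁻ y in annulus n x t, V y) ^ ((p₁ - p₂) / (p₁ * p₂)) * W₂ t ^ (1 / q₂)) t hxt
    rw [ENNReal.rpow_neg, mul_comm, ← div_eq_mul_inv,
      ENNReal.div_le_iff (r10 x hx) (r1t x hx)] at h1
    exact h1
  have hnec : ∀ C : ℝ≥0∞, (∀ f : EuclideanSpace ℝ (Fin n) → ℝ≥0∞, Measurable f →
        LMnorm n p₂ q₂ v₂ w₂ f ≤ C * LMnorm n p₁ q₁ v₁ w₁ f) → I₁ ≤ C := by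
    intro C hC
    refine iSup₂_le fun x hx => ?_
    have hx : 0 < x := hx
    rw [ENNReal.rpow_neg, mul_comm, ← div_eq_mul_inv, ENNReal.div_le_iff (r10 x hx) (r1t x hx)]
    refine iSup₂_le fun t hxt => ?_
    have hxt : x < t := hxt
    have ht : 0 < t := hx.trans hxt
    rw [← ENNReal.le_div_iff_mul_le (.inl (r20 t ht)) (.inl (r2t t ht)),
      ← ENNReal.le_rpow_inv_iff hr]
    rw [← withDensity_apply _ (H_ann_meas n x t)]
    have e : (volume.withDensity V) (annulus n x t) =
        (volume.withDensity V) (annulus n x t ∩ {y | V y < ⊤}) := by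
      apply measure_congr
      apply (withDensity_absolutelyContinuous volume V).ae_le
      filter_upwards [hVp] with y hy
      apply propext
      exact ⟨fun h => ⟨h, hy.2⟩, fun h => h.1⟩
    rw [e]
    apply H_L0 _ (fun y => (V y).toReal)
    intro z hz
    have hEm : MeasurableSet (annulus n x t ∩ {y | V y < ⊤} ∩ {y | (V y).toReal ≤ (V z).toReal}) :=
      ((H_ann_meas n x t).inter (hVm measurableSet_Iio)).inter
        (hVm.ennreal_toReal measurableSet_Iic)
    rw [withDensity_apply _ hEm, ENNReal.le_rpow_inv_iff hr,
      ENNReal.le_div_iff_mul_le (.inl (r20 t ht)) (.inl (r2t t ht))]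
    apply H_nec n p₁ p₂ q₁ q₂ hq₁ hp₂ hp₂p₁ hq₂ v₁ v₂ V w₁ w₂ hv₁m hv₁ hVm (fun _ => rfl) C
      hC x t hx hxt _ hEm (fun y hy => hy.1.1)
    refine ne_top_of_le_ne_top (b := V z * volume (annulus n x t)) ?_ ?_
    · refine ENNReal.mul_ne_top (ne_of_lt hz.2) ?_
      have : annulus n x t ⊆ Metric.ball 0 t := fun y hy => by simpa using hy.2
      exact ((measure_mono this).trans_lt measure_ball_lt_top).ne
    · calc _ ≤ ∫⁻ y in annulus n x t ∩ {y | V y < ⊤} ∩ {y | (V y).toReal ≤ (V z).toReal}, V z := by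
            apply setLIntegral_mono' hEm
            intro y hy
            exact (ENNReal.toReal_le_toReal (ne_of_lt hy.1.2) (ne_of_lt hz.2)).1 hy.2
        _ = V z * volume (annulus n x t ∩ {y | V y < ⊤} ∩ {y | (V y).toReal ≤ (V z).toReal}) := by
            rw [setLIntegral_const]
        _ ≤ _ := by gcongr; exact fun y hy => hy.1.1
  have hI0 : I₁ ≠ 0 := by
    intro h0
    have h := hI 1 2 (by norm_num) (by norm_num)
    rw [h0, zero_mul, nonpos_iff_eq_zero, mul_eq_zero] at h
    rcases h with h | h
    · rw [ENNReal.rpow_eq_zero_iff_of_pos hr, lintegral_eq_zero_iff hVm] at h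
      have h2 : ∀ᵐ s ∂(volume.restrict (annulus n 1 2)), False := by
        filter_upwards [h, ae_restrict_of_ae hVp] with s hs hs1
        exact hs1.1.ne' hs
      rw [ae_iff] at h2
      simp only [not_false_eq_true, ofPred_true, Measure.restrict_apply_univ] at h2
      exact H_ann_pos n hn h2
    · exact r20 2 (by norm_num) h
  set c : ℝ≥0∞ := (4 * 2 ^ (p₂/p₁) * 8 ^ (p₂/q₁)) ^ (1/p₂) with hc
  have hct : c ≠ ⊤ := by
    apply ENNReal.rpow_ne_top_of_nonneg (by positivity)
    refine ENNReal.mul_ne_top (ENNReal.mul_ne_top (by simp) ?_) ?_ <;>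
    exact ENNReal.rpow_ne_top_of_nonneg (by positivity) (by simp)
  have hc0 : c ≠ 0 := by
    refine (ENNReal.rpow_pos (pos_iff_ne_zero.2 ?_) ?_).ne'
    · refine mul_ne_zero (mul_ne_zero (by simp) ?_) ?_ <;>
      exact (ENNReal.rpow_pos (by simp) (by simp)).ne'
    · refine ENNReal.mul_ne_top (ENNReal.mul_ne_top (by simp) ?_) ?_ <;>
      exact ENNReal.rpow_ne_top_of_nonneg (by positivity) (by simp)
  have hsuff : I₁ ≠ ⊤ → ∀ f : EuclideanSpace ℝ (Fin n) → ℝ≥0∞, Measurable f →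
        LMnorm n p₂ q₂ v₂ w₂ f ≤ (c * I₁) * LMnorm n p₁ q₁ v₁ w₁ f := by
    intro hIt f hf
    have s0 : ∀ (g : EuclideanSpace ℝ (Fin n) → ℝ≥0∞) (s : ℝ),
        (volume.withDensity g) {y | ‖y‖ = s} = 0 := fun g s =>
      withDensity_absolutelyContinuous volume g (H_sphere n hn s)
    have hS := H_suff (fun y : EuclideanSpace ℝ (Fin n) => ‖y‖) measurable_norm
      (volume.withDensity fun s => f s ^ p₂ * v₂ s ^ p₂)
      (volume.withDensity fun s => f s ^ p₁ * v₁ s ^ p₁)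
      (volume.withDensity V) μ₁ μ₂ p₁ p₂ q₁ q₂ hq₁ hq₁p₂ hp₂p₁ hp₂q₂ hp₁q₂
      (fun E hE => by
        rw [withDensity_apply _ hE, withDensity_apply _ hE, withDensity_apply _ hE]
        exact H_holder _ p₁ p₂ hp₂ hp₂p₁ f v₁ v₂ hf hv₁m hv₂m (ae_restrict_of_ae hv₁))
      (s0 _) (s0 _) a2 b2 a3 b3
      (fun t ht => by rw [a1 t ht]; exact W1t t ht) (fun t ht => by rw [b1 t ht]; exact W2t t ht)
      I₁ hI0 hIt (fun x t hx hxt => by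
        have := hI x t hx hxt
        rw [a1 x hx, b1 t (hx.trans hxt)]
        rw [← withDensity_apply _ (H_ann_meas n x t)] at this
        exact this)
    have mm : ∀ (g : EuclideanSpace ℝ (Fin n) → ℝ≥0∞) (r : ℝ), Measurable fun t : ℝ =>
        (volume.withDensity g) {y | 0 < ‖y‖ ∧ ‖y‖ < t} ^ r := by
      intro g r
      have : Monotone fun t : ℝ => (volume.withDensity g)
          {y : EuclideanSpace ℝ (Fin n) | 0 < ‖y‖ ∧ ‖y‖ < t} :=
        fun s t hst => measure_mono fun y hy => ⟨hy.1, lt_of_lt_of_le hy.2 hst⟩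
      exact this.measurable.pow_const r
    rw [a4 _ (mm _ _), b4 _ (mm _ _)] at hS
    have ee : ∀ (g : EuclideanSpace ℝ (Fin n) → ℝ≥0∞) (t : ℝ),
        (volume.withDensity g) {y | 0 < ‖y‖ ∧ ‖y‖ < t} = ∫⁻ y in annulus n 0 t, g y :=
      fun g t => withDensity_apply g (H_ann_meas n 0 t)
    simp_rw [ee] at hS
    exact hS
  refine ⟨⟨?_, ?_⟩, 1, c, by simp, hct, ?_, ?_⟩
  · rintro ⟨C, hCt, hC⟩
    exact (hnec C hC).trans_lt hCt.lt_top
  · intro h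
    exact ⟨c * I₁, ENNReal.mul_ne_top hct h.ne, hsuff h.ne⟩
  · rw [one_mul]
    exact le_sInf fun C hC => hnec C hC
  · by_cases h : I₁ = ⊤
    · rw [h, ENNReal.mul_top hc0]; exact le_top
    · exact sInf_le (hsuff h)
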